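/- arXiv:1409.4053 — 9 statements merged into one kernel-verified Lean document; each statement's English description precedes it below -/
import Mathlib

section
/- Suppose the pair (μ₁,μ₂) is perfect. Then there exist real sequences a, b, c, d : ℕ×ℕ → ℝ with a_{0,m} = 0 for all m and b_{n,0} = 0 for all n, such that for all n,m ≥ 0 the multiple orthogonal polynomials satisfy the nearest-neighbor recurrence relations: P_{n+1,m}(x) = (x − c_{n,m})P_{n,m}(x) − a_{n,m}P_{n−1,m}(x) − b_{n,m}P_{n,m−1}(x) and P_{n,m+1}(x) = (x − d_{n,m})P_{n,m}(x) − a_{n,m}P_{n−1,m}(x) − b_{n,m}P_{n,m−1}(x), where terms with a negative index are omitted. -/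
open MeasureTheory Polynomial

/-- The `k`-th moment of a measure `μ` on `ℝ`. -/
noncomputable def mom (μ : Measure ℝ) (k : ℕ) : ℝ := ∫ x, x ^ k ∂μ

/-- The `(n+m)×(n+m)` moment matrix of the pair `(μ₁, μ₂)`: column `j` contains the
moments `s_{i+j}^{(1)}` for `j < n` and `s_{i+j-n}^{(2)}` for `n ≤ j < n+m`. -/
noncomputable def Smat (μ₁ μ₂ : Measure ℝ) (n m : ℕ) :
    Matrix (Fin (n + m)) (Fin (n + m)) ℝ :=
  Matrix.of fun i j =>
    if (j : ℕ) < n then mom μ₁ ((i : ℕ) + (j : ℕ))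
    else mom μ₂ ((i : ℕ) + (j : ℕ) - n)

/-- The determinant `S_{n,m}` (with `S_{0,0} = 1`). -/
noncomputable def Sdet (μ₁ μ₂ : Measure ℝ) (n m : ℕ) : ℝ := (Smat μ₁ μ₂ n m).det

/-- The `(n+m+1)×(n+m+1)` matrix over `ℝ[x]` whose determinant (normalized by `S_{n,m}`)
gives the multiple orthogonal polynomial `P_{n,m}`. -/
noncomputable def Pmat (μ₁ μ₂ : Measure ℝ) (n m : ℕ) :
    Matrix (Fin (n + m + 1)) (Fin (n + m + 1)) (Polynomial ℝ) :=
  Matrix.of fun i j =>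
    if (j : ℕ) < n then C (mom μ₁ ((i : ℕ) + (j : ℕ)))
    else if (j : ℕ) < n + m then C (mom μ₂ ((i : ℕ) + (j : ℕ) - n))
    else X ^ (i : ℕ)

/-- The multiple orthogonal (Hermite–Padé) polynomial `P_{n,m}`. -/
noncomputable def Ppoly (μ₁ μ₂ : Measure ℝ) (n m : ℕ) : Polynomial ℝ :=
  (Sdet μ₁ μ₂ n m)⁻¹ • (Pmat μ₁ μ₂ n m).det

/-- The moment functional `p ↦ ∫ p dμ`, defined through the moments of `μ`. -/
noncomputable def momFunctional (μ : Measure ℝ) : ℝ[X] →ₗ[ℝ] ℝ :=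
  (Polynomial.basisMonomials ℝ).constr ℝ (mom μ)

lemma momFunctional_monomial (μ : Measure ℝ) (k : ℕ) (r : ℝ) :
    momFunctional μ (monomial k r) = r * mom μ k := by
  have h : momFunctional μ (monomial k 1) = mom μ k := by
    simpa [momFunctional] using (Polynomial.basisMonomials ℝ).constr_basis ℝ (mom μ) k
  rw [← mul_one r, ← smul_eq_mul r 1, ← smul_monomial, map_smul, h]
  simp

lemma momFunctional_X_pow_mul (μ : Measure ℝ) (k N : ℕ) (p : ℝ[X]) (hp : p.degree < N) :
    momFunctional μ (X ^ k * p) = ∑ i : Fin N, p.coeff i * mom μ (i + k) := by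
  rw [Fin.sum_univ_eq_sum_range (fun i => p.coeff i * mom μ (i + k)) N]
  have hsum : p = ∑ i ∈ Finset.range N, monomial i (p.coeff i) := by
    ext j
    simp only [finsetSum_coeff, coeff_monomial, Finset.sum_ite_eq', Finset.mem_range]
    split_ifs with h
    · rfl
    · exact coeff_eq_zero_of_degree_lt (hp.trans_le (by exact_mod_cast not_lt.mp h))
  conv_lhs => rw [hsum]
  rw [Finset.mul_sum, map_sum]
  refine Finset.sum_congr rfl fun i _ => ?_
  rw [X_pow_mul_monomial, momFunctional_monomial]

/-- The orthogonality conditions of the multi-index `(n, m)`. -/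
def IsMultiOrthogonal (μ₁ μ₂ : Measure ℝ) (n m : ℕ) (p : ℝ[X]) : Prop :=
  (∀ k < n, momFunctional μ₁ (X ^ k * p) = 0) ∧ (∀ k < m, momFunctional μ₂ (X ^ k * p) = 0)

namespace IsMultiOrthogonal

variable {μ₁ μ₂ : Measure ℝ} {n m : ℕ} {p q : ℝ[X]}

lemma mono {n' m' : ℕ} (hp : IsMultiOrthogonal μ₁ μ₂ n m p) (hn : n' ≤ n) (hm : m' ≤ m) :
    IsMultiOrthogonal μ₁ μ₂ n' m' p :=
  ⟨fun k hk => hp.1 k (hk.trans_le hn), fun k hk => hp.2 k (hk.trans_le hm)⟩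

lemma sub (hp : IsMultiOrthogonal μ₁ μ₂ n m p) (hq : IsMultiOrthogonal μ₁ μ₂ n m q) :
    IsMultiOrthogonal μ₁ μ₂ n m (p - q) :=
  ⟨fun k hk => by rw [mul_sub, map_sub, hp.1 k hk, hq.1 k hk, sub_zero],
    fun k hk => by rw [mul_sub, map_sub, hp.2 k hk, hq.2 k hk, sub_zero]⟩

lemma C_mul (hp : IsMultiOrthogonal μ₁ μ₂ n m p) (r : ℝ) :
    IsMultiOrthogonal μ₁ μ₂ n m (C r * p) := by
  rw [← smul_eq_C_mul]
  exact ⟨fun k hk => by rw [mul_smul_comm, map_smul, hp.1 k hk, smul_zero],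
    fun k hk => by rw [mul_smul_comm, map_smul, hp.2 k hk, smul_zero]⟩

lemma X_mul (hp : IsMultiOrthogonal μ₁ μ₂ n m p) :
    IsMultiOrthogonal μ₁ μ₂ (n - 1) (m - 1) (X * p) :=
  ⟨fun k hk => by rw [← mul_assoc, ← pow_succ]; exact hp.1 _ (by omega),
    fun k hk => by rw [← mul_assoc, ← pow_succ]; exact hp.2 _ (by omega)⟩

/-- A normal index admits no nonzero orthogonal polynomial of degree below `n + m`. -/
lemma eq_zero (hp : IsMultiOrthogonal μ₁ μ₂ n m p) (hS : Sdet μ₁ μ₂ n m ≠ 0)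
    (hdeg : p.degree < (n + m : ℕ)) : p = 0 := by
  have hv : (fun i : Fin (n + m) => p.coeff i) = 0 := by
    refine Matrix.eq_zero_of_vecMul_eq_zero hS ?_
    ext j
    simp only [Matrix.vecMul, dotProduct, Smat, Matrix.of_apply, Pi.zero_apply]
    by_cases hj : (j : ℕ) < n
    · simp only [hj, if_true]
      rw [← momFunctional_X_pow_mul μ₁ j _ p hdeg]
      exact hp.1 _ hj
    · simp only [hj, if_false, Nat.add_sub_assoc (not_lt.mp hj)]
      rw [← momFunctional_X_pow_mul μ₂ (j - n) _ p hdeg]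
      exact hp.2 _ (by omega)
  ext i
  by_cases hi : i < n + m
  · exact congrFun hv ⟨i, hi⟩
  · exact coeff_eq_zero_of_degree_lt (hdeg.trans_le (by exact_mod_cast not_lt.mp hi))

/-- One further orthogonality condition raises the first index by one. -/
lemma succ_left (hp : IsMultiOrthogonal μ₁ μ₂ n m p)
    (h : momFunctional μ₁ (X ^ n * p) = 0) : IsMultiOrthogonal μ₁ μ₂ (n + 1) m p :=
  ⟨fun k hk => (Nat.lt_succ_iff_lt_or_eq.mp hk).elim (hp.1 k) fun e => e ▸ h, hp.2⟩

/-- One further orthogonality condition raises the second index by one. -/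
lemma succ_right (hp : IsMultiOrthogonal μ₁ μ₂ n m p)
    (h : momFunctional μ₂ (X ^ m * p) = 0) : IsMultiOrthogonal μ₁ μ₂ n (m + 1) p :=
  ⟨hp.1, fun k hk => (Nat.lt_succ_iff_lt_or_eq.mp hk).elim (hp.2 k) fun e => e ▸ h⟩

end IsMultiOrthogonal

/-- The moment matrix of `(n, m)` with `n + m + 1` rows, bordered by a last column `w`. -/
noncomputable def borderedMat (μ₁ μ₂ : Measure ℝ) (n m : ℕ) (w : ℕ → ℝ) :
    Matrix (Fin (n + m + 1)) (Fin (n + m + 1)) ℝ :=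
  Matrix.of fun i j =>
    if (j : ℕ) < n then mom μ₁ ((i : ℕ) + (j : ℕ))
    else if (j : ℕ) < n + m then mom μ₂ ((i : ℕ) + (j : ℕ) - n)
    else w i

/-- The cofactors of the last column of `borderedMat`. -/
noncomputable def borderedCofactor (μ₁ μ₂ : Measure ℝ) (n m : ℕ) (i : Fin (n + m + 1)) : ℝ :=
  (-1) ^ ((i : ℕ) + (n + m)) *
    ((borderedMat μ₁ μ₂ n m 0).submatrix i.succAbove (Fin.last (n + m)).succAbove).det

lemma det_borderedMat (μ₁ μ₂ : Measure ℝ) (n m : ℕ) (w : ℕ → ℝ) :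
    (borderedMat μ₁ μ₂ n m w).det = ∑ i, borderedCofactor μ₁ μ₂ n m i * w i := by
  rw [Matrix.det_succ_column _ (Fin.last (n + m))]
  refine Finset.sum_congr rfl fun i _ => ?_
  have hsub : (borderedMat μ₁ μ₂ n m w).submatrix i.succAbove (Fin.last (n + m)).succAbove =
      (borderedMat μ₁ μ₂ n m 0).submatrix i.succAbove (Fin.last (n + m)).succAbove := by
    ext r j
    simp [borderedMat]
  rw [hsub, borderedCofactor]
  simp only [borderedMat, Matrix.of_apply, Fin.val_last]
  rw [if_neg (by omega), if_neg (by omega)]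
  ring

lemma det_Pmat (μ₁ μ₂ : Measure ℝ) (n m : ℕ) :
    (Pmat μ₁ μ₂ n m).det =
      ∑ i : Fin (n + m + 1), C (borderedCofactor μ₁ μ₂ n m i) * X ^ (i : ℕ) := by
  rw [Matrix.det_succ_column _ (Fin.last (n + m))]
  refine Finset.sum_congr rfl fun i _ => ?_
  have hsub : (Pmat μ₁ μ₂ n m).submatrix i.succAbove (Fin.last (n + m)).succAbove =
      (C : ℝ →+* ℝ[X]).mapMatrix
        ((borderedMat μ₁ μ₂ n m 0).submatrix i.succAbove (Fin.last (n + m)).succAbove) := by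
    ext1 r j
    simp only [Pmat, borderedMat, Matrix.submatrix_apply, Matrix.of_apply,
      RingHom.mapMatrix_apply, Matrix.map_apply, Fin.succAbove_last, Fin.val_castSucc, j.isLt,
      if_true]
    split_ifs <;> rfl
  rw [hsub, ← RingHom.map_det, borderedCofactor]
  simp only [Pmat, Matrix.of_apply, Fin.val_last]
  rw [if_neg (by omega), if_neg (by omega), C_mul, C_pow, C_neg, C_1]
  ring

lemma borderedCofactor_last (μ₁ μ₂ : Measure ℝ) (n m : ℕ) :
    borderedCofactor μ₁ μ₂ n m (Fin.last (n + m)) = Sdet μ₁ μ₂ n m := by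
  rw [borderedCofactor, Fin.val_last, Even.neg_one_pow ⟨_, rfl⟩, one_mul, Sdet]
  congr 1
  ext i j
  simp [borderedMat, Smat]

lemma coeff_det_Pmat (μ₁ μ₂ : Measure ℝ) (n m : ℕ) (i : Fin (n + m + 1)) :
    (Pmat μ₁ μ₂ n m).det.coeff i = borderedCofactor μ₁ μ₂ n m i := by
  rw [det_Pmat, finsetSum_coeff]
  simp [coeff_X_pow, Fin.val_inj]

lemma degree_det_Pmat_lt (μ₁ μ₂ : Measure ℝ) (n m : ℕ) :
    (Pmat μ₁ μ₂ n m).det.degree < (n + m + 1 : ℕ) := by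
  rw [det_Pmat]
  refine (degree_sum_le _ _).trans_lt ((Finset.sup_lt_iff (WithBot.bot_lt_coe _)).mpr ?_)
  intro i _
  exact (degree_C_mul_X_pow_le _ _).trans_lt (by exact_mod_cast i.isLt)

lemma momFunctional_X_pow_mul_det_Pmat (μ μ₁ μ₂ : Measure ℝ) (n m k : ℕ) :
    momFunctional μ (X ^ k * (Pmat μ₁ μ₂ n m).det) =
      (borderedMat μ₁ μ₂ n m fun i => mom μ (i + k)).det := by
  rw [momFunctional_X_pow_mul μ k _ _ (degree_det_Pmat_lt μ₁ μ₂ n m), det_borderedMat]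
  simp only [coeff_det_Pmat]

lemma isMultiOrthogonal_Ppoly (μ₁ μ₂ : Measure ℝ) (n m : ℕ) :
    IsMultiOrthogonal μ₁ μ₂ n m (Ppoly μ₁ μ₂ n m) := by
  rw [Ppoly, smul_eq_C_mul]
  refine IsMultiOrthogonal.C_mul ⟨fun k hk => ?_, fun k hk => ?_⟩ _ <;>
    rw [momFunctional_X_pow_mul_det_Pmat]
  · refine Matrix.det_zero_of_column_eq (i := ⟨k, by omega⟩) (j := Fin.last (n + m))
      (by simp [Fin.ext_iff]; omega) fun r => ?_
    simp [borderedMat, hk]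
  · refine Matrix.det_zero_of_column_eq (i := ⟨n + k, by omega⟩) (j := Fin.last (n + m))
      (by simp [Fin.ext_iff]; omega) fun r => ?_
    simp only [borderedMat, Matrix.of_apply, Fin.val_last]
    rw [if_neg (by omega), if_pos (by omega), if_neg (by omega), if_neg (by omega)]
    congr 1
    omega

section Normal

variable {μ₁ μ₂ : Measure ℝ} {n m : ℕ}

lemma degree_Ppoly_lt (μ₁ μ₂ : Measure ℝ) (n m : ℕ) :
    (Ppoly μ₁ μ₂ n m).degree < (n + m + 1 : ℕ) :=
  (degree_smul_le _ _).trans_lt (degree_det_Pmat_lt μ₁ μ₂ n m)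

lemma coeff_Ppoly (hS : Sdet μ₁ μ₂ n m ≠ 0) : (Ppoly μ₁ μ₂ n m).coeff (n + m) = 1 := by
  have h := coeff_det_Pmat μ₁ μ₂ n m (Fin.last (n + m))
  rw [Fin.val_last, borderedCofactor_last] at h
  rw [Ppoly, coeff_smul, h, smul_eq_mul, inv_mul_cancel₀ hS]

lemma Ppoly_ne_zero (hS : Sdet μ₁ μ₂ n m ≠ 0) : Ppoly μ₁ μ₂ n m ≠ 0 := fun h => by
  simpa [h] using coeff_Ppoly hS

lemma degree_lt_of_coeff_eq_zero {p : ℝ[X]} {N : ℕ} (hp : p.degree < (N + 1 : ℕ))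
    (h : p.coeff N = 0) : p.degree < N := by
  rw [degree_lt_iff_coeff_zero] at hp ⊢
  intro k hk
  rcases hk.eq_or_lt with rfl | hk
  · exact h
  · exact hp k hk

/-- An orthogonal polynomial of degree at most `n + m` is a multiple of `P_{n,m}`. -/
lemma IsMultiOrthogonal.eq_C_mul_Ppoly {p : ℝ[X]} (hp : IsMultiOrthogonal μ₁ μ₂ n m p)
    (hS : Sdet μ₁ μ₂ n m ≠ 0) (hdeg : p.degree < (n + m + 1 : ℕ)) :
    p = C (p.coeff (n + m)) * Ppoly μ₁ μ₂ n m := by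
  refine sub_eq_zero.mp ((hp.sub ((isMultiOrthogonal_Ppoly μ₁ μ₂ n m).C_mul _)).eq_zero hS ?_)
  refine degree_lt_of_coeff_eq_zero ?_ (by simp [coeff_Ppoly hS])
  refine (degree_sub_le _ _).trans_lt (max_lt hdeg ?_)
  rw [← smul_eq_C_mul]
  exact (degree_smul_le _ _).trans_lt (degree_Ppoly_lt μ₁ μ₂ n m)

lemma momFunctional_Ppoly_left_ne_zero (hS : Sdet μ₁ μ₂ n m ≠ 0)
    (hS' : Sdet μ₁ μ₂ (n + 1) m ≠ 0) : momFunctional μ₁ (X ^ n * Ppoly μ₁ μ₂ n m) ≠ 0 :=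
  fun h => Ppoly_ne_zero hS <| ((isMultiOrthogonal_Ppoly μ₁ μ₂ n m).succ_left h).eq_zero hS' <| by
    simpa only [Nat.add_right_comm] using degree_Ppoly_lt μ₁ μ₂ n m

lemma momFunctional_Ppoly_right_ne_zero (hS : Sdet μ₁ μ₂ n m ≠ 0)
    (hS' : Sdet μ₁ μ₂ n (m + 1) ≠ 0) : momFunctional μ₂ (X ^ m * Ppoly μ₁ μ₂ n m) ≠ 0 :=
  fun h => Ppoly_ne_zero hS <| ((isMultiOrthogonal_Ppoly μ₁ μ₂ n m).succ_right h).eq_zero hS' <|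
    degree_Ppoly_lt μ₁ μ₂ n m

end Normal

section Perfect

variable {μ₁ μ₂ : Measure ℝ}

/-- Subtracting a multiple of `P_{n-1,m}` raises the first orthogonality index to `n`. -/
lemma exists_sub_left (hS : ∀ n m, Sdet μ₁ μ₂ n m ≠ 0) {n m m' : ℕ} {p : ℝ[X]}
    (hp : IsMultiOrthogonal μ₁ μ₂ (n - 1) m' p) (hm : m' ≤ m) (hdeg : p.degree < (n + m : ℕ)) :
    ∃ a : ℝ, (n = 0 → a = 0) ∧
      IsMultiOrthogonal μ₁ μ₂ n m' (p - if n = 0 then 0 else C a * Ppoly μ₁ μ₂ (n - 1) m) ∧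
      (p - if n = 0 then 0 else C a * Ppoly μ₁ μ₂ (n - 1) m).degree < (n + m : ℕ) := by
  cases n with
  | zero => exact ⟨0, fun _ => rfl, by simpa using hp, by simpa using hdeg⟩
  | succ n =>
    simp only [Nat.add_sub_cancel, Nat.add_eq_zero_iff, one_ne_zero, and_false, if_false] at hp ⊢
    have hne := momFunctional_Ppoly_left_ne_zero (hS n m) (hS (n + 1) m)
    refine ⟨momFunctional μ₁ (X ^ n * p) / momFunctional μ₁ (X ^ n * Ppoly μ₁ μ₂ n m),
      False.elim, (hp.sub (((isMultiOrthogonal_Ppoly μ₁ μ₂ n m).mono le_rfl hm).C_mul _)).succ_left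
        ?_, (degree_sub_le _ _).trans_lt (max_lt hdeg ?_)⟩
    · rw [← smul_eq_C_mul, mul_sub, mul_smul_comm, map_sub, map_smul, smul_eq_mul,
        div_mul_cancel₀ _ hne, sub_self]
    · rw [← smul_eq_C_mul, Nat.add_right_comm]
      exact (degree_smul_le _ _).trans_lt (degree_Ppoly_lt μ₁ μ₂ n m)

/-- Subtracting a multiple of `P_{n,m-1}` raises the second orthogonality index to `m`. -/
lemma exists_sub_right (hS : ∀ n m, Sdet μ₁ μ₂ n m ≠ 0) {n m n' : ℕ} {p : ℝ[X]}
    (hp : IsMultiOrthogonal μ₁ μ₂ n' (m - 1) p) (hn : n' ≤ n) (hdeg : p.degree < (n + m : ℕ)) :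
    ∃ b : ℝ, (m = 0 → b = 0) ∧
      IsMultiOrthogonal μ₁ μ₂ n' m (p - if m = 0 then 0 else C b * Ppoly μ₁ μ₂ n (m - 1)) ∧
      (p - if m = 0 then 0 else C b * Ppoly μ₁ μ₂ n (m - 1)).degree < (n + m : ℕ) := by
  cases m with
  | zero => exact ⟨0, fun _ => rfl, by simpa using hp, by simpa using hdeg⟩
  | succ m =>
    simp only [Nat.add_sub_cancel, Nat.add_eq_zero_iff, one_ne_zero, and_false, if_false] at hp ⊢
    have hne := momFunctional_Ppoly_right_ne_zero (hS n m) (hS n (m + 1))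
    refine ⟨momFunctional μ₂ (X ^ m * p) / momFunctional μ₂ (X ^ m * Ppoly μ₁ μ₂ n m),
      False.elim, (hp.sub (((isMultiOrthogonal_Ppoly μ₁ μ₂ n m).mono hn le_rfl).C_mul _)).succ_right
        ?_, (degree_sub_le _ _).trans_lt (max_lt hdeg ?_)⟩
    · rw [← smul_eq_C_mul, mul_sub, mul_smul_comm, map_sub, map_smul, smul_eq_mul,
        div_mul_cancel₀ _ hne, sub_self]
    · rw [← smul_eq_C_mul]
      exact (degree_smul_le _ _).trans_lt (degree_Ppoly_lt μ₁ μ₂ n m)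

lemma degree_X_mul_Ppoly_sub_lt (hS : ∀ n m, Sdet μ₁ μ₂ n m ≠ 0) (n m : ℕ) :
    (X * Ppoly μ₁ μ₂ n m - Ppoly μ₁ μ₂ (n + 1) m).degree < ((n + m + 1 : ℕ) : WithBot ℕ) := by
  have h := coeff_Ppoly (hS (n + 1) m)
  rw [Nat.add_right_comm] at h
  refine degree_lt_of_coeff_eq_zero ((degree_sub_le _ _).trans_lt (max_lt ?_ ?_)) ?_
  · rw [degree_mul, degree_X, add_comm, Nat.cast_add _ 1]
    exact WithBot.add_lt_add_right (by simp) (degree_Ppoly_lt μ₁ μ₂ n m)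
  · simpa only [Nat.add_right_comm] using degree_Ppoly_lt μ₁ μ₂ (n + 1) m
  · rw [coeff_sub, coeff_X_mul, coeff_Ppoly (hS n m), h, sub_self]

lemma exists_recurrence_left (hS : ∀ n m, Sdet μ₁ μ₂ n m ≠ 0) (n m : ℕ) :
    ∃ a b c : ℝ, (n = 0 → a = 0) ∧ (m = 0 → b = 0) ∧
      Ppoly μ₁ μ₂ (n + 1) m = (X - C c) * Ppoly μ₁ μ₂ n m
        - (if n = 0 then 0 else C a * Ppoly μ₁ μ₂ (n - 1) m)
        - (if m = 0 then 0 else C b * Ppoly μ₁ μ₂ n (m - 1)) := by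
  set q := X * Ppoly μ₁ μ₂ n m - Ppoly μ₁ μ₂ (n + 1) m with hq
  have hqdeg : q.degree < (n + m + 1 : ℕ) := degree_X_mul_Ppoly_sub_lt hS n m
  have hP := isMultiOrthogonal_Ppoly μ₁ μ₂ n m
  have hr : IsMultiOrthogonal μ₁ μ₂ (n - 1) (m - 1)
      (q - C (q.coeff (n + m)) * Ppoly μ₁ μ₂ n m) :=
    (hP.X_mul.sub ((isMultiOrthogonal_Ppoly μ₁ μ₂ (n + 1) m).mono (by omega) (by omega))).sub
      ((hP.C_mul _).mono (by omega) (by omega))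
  have hrdeg : (q - C (q.coeff (n + m)) * Ppoly μ₁ μ₂ n m).degree < (n + m : ℕ) := by
    refine degree_lt_of_coeff_eq_zero ((degree_sub_le _ _).trans_lt (max_lt hqdeg ?_))
      (by simp [coeff_Ppoly (hS n m)])
    rw [← smul_eq_C_mul]
    exact (degree_smul_le _ _).trans_lt (degree_Ppoly_lt μ₁ μ₂ n m)
  obtain ⟨a, ha, hra, hradeg⟩ := exists_sub_left hS hr (Nat.sub_le m 1) hrdeg
  obtain ⟨b, hb, hrb, hrbdeg⟩ := exists_sub_right hS hra le_rfl hradeg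
  refine ⟨a, b, q.coeff (n + m), ha, hb, ?_⟩
  linear_combination -(hrb.eq_zero (hS n m) hrbdeg) + hq

lemma exists_Ppoly_succ_right_eq (hS : ∀ n m, Sdet μ₁ μ₂ n m ≠ 0) (n m : ℕ) :
    ∃ e : ℝ, Ppoly μ₁ μ₂ n (m + 1) = Ppoly μ₁ μ₂ (n + 1) m - C e * Ppoly μ₁ μ₂ n m := by
  have h := coeff_Ppoly (hS (n + 1) m)
  rw [Nat.add_right_comm] at h
  have heq := (((isMultiOrthogonal_Ppoly μ₁ μ₂ (n + 1) m).mono n.le_succ le_rfl).sub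
    ((isMultiOrthogonal_Ppoly μ₁ μ₂ n (m + 1)).mono le_rfl m.le_succ)).eq_C_mul_Ppoly (hS n m) (by
      refine degree_lt_of_coeff_eq_zero ((degree_sub_le _ _).trans_lt (max_lt ?_ ?_)) ?_
      · simpa only [Nat.add_right_comm] using degree_Ppoly_lt μ₁ μ₂ (n + 1) m
      · exact degree_Ppoly_lt μ₁ μ₂ n (m + 1)
      · rw [coeff_sub, h]
        exact sub_eq_zero.mpr (coeff_Ppoly (hS n (m + 1))).symm)
  exact ⟨_, by linear_combination -heq⟩

end Perfect

/-- For a perfect system `(μ₁, μ₂)` the multiple orthogonal polynomials satisfy the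
nearest-neighbor recurrence relations (terms with a negative index omitted). -/
theorem nearest_neighbor_recurrence_of_perfect (μ₁ μ₂ : Measure ℝ)
    (h₁ : ∀ k : ℕ, Integrable (fun x => x ^ k) μ₁)
    (h₂ : ∀ k : ℕ, Integrable (fun x => x ^ k) μ₂)
    (hperfect : ∀ n m : ℕ, Sdet μ₁ μ₂ n m ≠ 0) :
    ∃ a b c d : ℕ → ℕ → ℝ,
      (∀ m, a 0 m = 0) ∧ (∀ n, b n 0 = 0) ∧
      (∀ n m : ℕ,
        Ppoly μ₁ μ₂ (n + 1) m =
          (X - C (c n m)) * Ppoly μ₁ μ₂ n m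
            - (if n = 0 then 0 else C (a n m) * Ppoly μ₁ μ₂ (n - 1) m)
            - (if m = 0 then 0 else C (b n m) * Ppoly μ₁ μ₂ n (m - 1))) ∧
      (∀ n m : ℕ,
        Ppoly μ₁ μ₂ n (m + 1) =
          (X - C (d n m)) * Ppoly μ₁ μ₂ n m
            - (if n = 0 then 0 else C (a n m) * Ppoly μ₁ μ₂ (n - 1) m)
            - (if m = 0 then 0 else C (b n m) * Ppoly μ₁ μ₂ n (m - 1))) := by
  choose a b c ha hb hrec using exists_recurrence_left hperfect
  choose e he using exists_Ppoly_succ_right_eq hperfect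
  refine ⟨a, b, c, fun n m => c n m + e n m, fun m => ha 0 m rfl, fun n => hb n 0 rfl, hrec,
    fun n m => ?_⟩
  rw [he, hrec, C_add]
  ring
end

section
/- Suppose the pair (μ₁,μ₂) is perfect, let n,m ≥ 0, and suppose real numbers c, d, a, b satisfy P_{n+1,m}(x) = (x − c)P_{n,m}(x) − a P_{n−1,m}(x) − b P_{n,m−1}(x) and P_{n,m+1}(x) = (x − d)P_{n,m}(x) − a P_{n−1,m}(x) − b P_{n,m−1}(x) (terms with a negative index omitted). Then d − c = S_{n,m} S_{n+1,m+1} / (S_{n+1,m} S_{n,m+1}); in particular c ≠ d. -/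
open MeasureTheory Polynomial

/-- The functional `x ^ i ↦ s i` on polynomials. -/
noncomputable def momentFunctional (s : ℕ → ℝ) : ℝ[X] →ₗ[ℝ] ℝ :=
  Polynomial.lsum fun i => s i • LinearMap.id

theorem momentFunctional_C_mul_X_pow (s : ℕ → ℝ) (r : ℝ) (i : ℕ) :
    momentFunctional s (C r * X ^ i) = r * s i := by
  rw [C_mul_X_pow_eq_monomial, momentFunctional, Polynomial.lsum_apply,
    Polynomial.sum_monomial_index _ _ (by simp)]
  simp [mul_comm]

/-- Applying a functional to a determinant whose last column consists of the monomials `x ^ i`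
replaces that column by the values of the functional. -/
theorem momentFunctional_det {N : ℕ} (s : ℕ → ℝ)
    (M : Matrix (Fin (N + 1)) (Fin (N + 1)) ℝ[X]) (B : Matrix (Fin (N + 1)) (Fin (N + 1)) ℝ)
    (hM : ∀ i (j : Fin N), M i j.castSucc = C (B i j.castSucc))
    (hlast : ∀ i, M i (Fin.last N) = X ^ (i : ℕ))
    (hB : ∀ i, B i (Fin.last N) = s i) :
    momentFunctional s M.det = B.det := by
  rw [Matrix.det_succ_column M (Fin.last N), Matrix.det_succ_column B (Fin.last N), map_sum]
  refine Finset.sum_congr rfl fun i _ => ?_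
  have hsub : M.submatrix i.succAbove (Fin.last N).succAbove =
      (C : ℝ →+* ℝ[X]).mapMatrix (B.submatrix i.succAbove (Fin.last N).succAbove) := by
    ext1 k j
    simp [hM]
  rw [hsub, ← RingHom.map_det, hlast, hB,
    show ∀ (e : ℕ) (p : ℝ[X]) (r : ℝ), (-1) ^ e * p * C r = C ((-1) ^ e * r) * p from
      fun e p r => by simp only [map_mul, map_pow, map_neg, map_one]; ring,
    momentFunctional_C_mul_X_pow]
  ring

/-- The integral of `x ^ m * P_{n,m}` against `μ₂`, in terms of moments. -/
theorem momentFunctional_Ppoly (μ₁ μ₂ : Measure ℝ) (n m : ℕ) :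
    momentFunctional (fun i => mom μ₂ (i + m)) (Ppoly μ₁ μ₂ n m) =
      (Sdet μ₁ μ₂ n m)⁻¹ * Sdet μ₁ μ₂ n (m + 1) := by
  rw [Ppoly, map_smul, smul_eq_mul,
    momentFunctional_det _ (Pmat μ₁ μ₂ n m) (Smat μ₁ μ₂ n (m + 1)) ?_ ?_ ?_]
  · rfl
  · intro i j
    simp only [Pmat, Smat, Matrix.of_apply, Fin.val_castSucc, j.isLt, if_true]
    split_ifs <;> rfl
  · intro i
    simp [Pmat]
  · intro i
    simp [Smat, show (i : ℕ) + (n + m) - n = i + m by omega]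

/-- Orthogonality of `P_{n,m+1}` to `x ^ m` with respect to `μ₂`, in terms of moments. -/
theorem momentFunctional_Ppoly_succ (μ₁ μ₂ : Measure ℝ) (n m : ℕ) :
    momentFunctional (fun i => mom μ₂ (i + m)) (Ppoly μ₁ μ₂ n (m + 1)) = 0 := by
  rw [Ppoly, map_smul, smul_eq_mul,
    momentFunctional_det _ (Pmat μ₁ μ₂ n (m + 1))
      (Matrix.of fun i j => if (j : ℕ) < n then mom μ₁ ((i : ℕ) + (j : ℕ))
        else if (j : ℕ) < n + (m + 1) then mom μ₂ ((i : ℕ) + (j : ℕ) - n)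
        else mom μ₂ (i + m)) ?_ ?_ ?_]
  · rw [Matrix.det_zero_of_column_eq (i := Fin.castSucc (Fin.last (n + m)))
      (j := Fin.last (n + (m + 1))), mul_zero]
    · exact (Fin.castSucc_lt_last _).ne
    · intro i
      simp [show (i : ℕ) + (n + m) - n = i + m by omega]
  · intro i j
    simp only [Pmat, Matrix.of_apply, Fin.val_castSucc, j.isLt, if_true]
    split_ifs <;> rfl
  · intro i
    simp [Pmat]
  · intro i
    simp

/-- For a perfect system, the difference `d - c` of the nearest-neighbor recurrence
coefficients equals `S_{n,m} S_{n+1,m+1} / (S_{n+1,m} S_{n,m+1})`; in particular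
`c ≠ d`. -/
theorem recurrence_coefficient_d_sub_c (μ₁ μ₂ : Measure ℝ)
    (h₁ : ∀ k : ℕ, Integrable (fun x => x ^ k) μ₁)
    (h₂ : ∀ k : ℕ, Integrable (fun x => x ^ k) μ₂)
    (hperfect : ∀ n m : ℕ, Sdet μ₁ μ₂ n m ≠ 0)
    (n m : ℕ) (c d a b : ℝ)
    (hrec1 : Ppoly μ₁ μ₂ (n + 1) m =
      (X - C c) * Ppoly μ₁ μ₂ n m
        - (if n = 0 then 0 else C a * Ppoly μ₁ μ₂ (n - 1) m)
        - (if m = 0 then 0 else C b * Ppoly μ₁ μ₂ n (m - 1)))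
    (hrec2 : Ppoly μ₁ μ₂ n (m + 1) =
      (X - C d) * Ppoly μ₁ μ₂ n m
        - (if n = 0 then 0 else C a * Ppoly μ₁ μ₂ (n - 1) m)
        - (if m = 0 then 0 else C b * Ppoly μ₁ μ₂ n (m - 1))) :
    d - c = Sdet μ₁ μ₂ n m * Sdet μ₁ μ₂ (n + 1) (m + 1) /
      (Sdet μ₁ μ₂ (n + 1) m * Sdet μ₁ μ₂ n (m + 1)) ∧ c ≠ d := by
  have hdiff : Ppoly μ₁ μ₂ (n + 1) m - Ppoly μ₁ μ₂ n (m + 1) =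
      (d - c) • Ppoly μ₁ μ₂ n m := by
    rw [hrec1, hrec2, Polynomial.smul_eq_C_mul, map_sub]
    ring
  have key := congrArg (momentFunctional fun i => mom μ₂ (i + m)) hdiff
  rw [map_sub, map_smul, momentFunctional_Ppoly, momentFunctional_Ppoly,
    momentFunctional_Ppoly_succ, sub_zero, smul_eq_mul] at key
  have h00 := hperfect n m
  have h10 := hperfect (n + 1) m
  have h01 := hperfect n (m + 1)
  have h11 := hperfect (n + 1) (m + 1)
  have hdc : d - c = Sdet μ₁ μ₂ n m * Sdet μ₁ μ₂ (n + 1) (m + 1) /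
      (Sdet μ₁ μ₂ (n + 1) m * Sdet μ₁ μ₂ n (m + 1)) := by
    field_simp at key ⊢
    linarith
  refine ⟨hdc, fun h => ?_⟩
  have hne : d - c ≠ 0 := hdc ▸ div_ne_zero (mul_ne_zero h00 h11) (mul_ne_zero h10 h01)
  exact hne (sub_eq_zero.mpr h.symm)
end

section
/- Let a, b, c, d : ℕ×ℕ → ℂ be such that c_{n,m} ≠ d_{n,m} for all n,m ≥ 0. Then the consistency conditions: (i) d_{n+1,m} − d_{n,m} = c_{n,m+1} − c_{n,m} for all n,m ≥ 0, (ii) b_{n+1,m} − b_{n,m+1} + a_{n+1,m} − a_{n,m+1} = d_{n+1,m}c_{n,m} − d_{n,m}c_{n,m+1} for all n,m ≥ 0, (iii) a_{n,m+1}(c_{n−1,m} − d_{n−1,m}) = a_{n,m}(c_{n,m} − d_{n,m}) for all n ≥ 1, m ≥ 0, and (iv) b_{n+1,m}(c_{n,m−1} − d_{n,m−1}) = b_{n,m}(c_{n,m} − d_{n,m}) for all n ≥ 0, m ≥ 1, hold if and only if the discrete system: (c_{n,m+1} − c_{n,m})(c_{n,m} − d_{n,m}) = (a_{n+1,m} +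 b_{n+1,m}) − (a_{n,m+1} + b_{n,m+1}), (d_{n+1,m} − d_{n,m})(c_{n,m} − d_{n,m}) = (a_{n+1,m} + b_{n+1,m}) − (a_{n,m+1} + b_{n,m+1}), together with the same equations (iii) and (iv), holds. -/
/-- Assuming `c_{n,m} ≠ d_{n,m}` everywhere, the consistency conditions for the
nearest-neighbor recurrence coefficients are equivalent to the discrete system
(zero curvature equations). -/
theorem consistency_iff_discrete_system (a b c d : ℕ → ℕ → ℂ)
    (hcd : ∀ n m : ℕ, c n m ≠ d n m) :
    ((∀ n m : ℕ, d (n + 1) m - d n m = c n (m + 1) - c n m) ∧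
     (∀ n m : ℕ, b (n + 1) m - b n (m + 1) + a (n + 1) m - a n (m + 1)
        = d (n + 1) m * c n m - d n m * c n (m + 1)) ∧
     (∀ n m : ℕ, 1 ≤ n →
        a n (m + 1) * (c (n - 1) m - d (n - 1) m) = a n m * (c n m - d n m)) ∧
     (∀ n m : ℕ, 1 ≤ m →
        b (n + 1) m * (c n (m - 1) - d n (m - 1)) = b n m * (c n m - d n m)))
    ↔
    ((∀ n m : ℕ, (c n (m + 1) - c n m) * (c n m - d n m)
        = (a (n + 1) m + b (n + 1) m) - (a n (m + 1) + b n (m + 1))) ∧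
     (∀ n m : ℕ, (d (n + 1) m - d n m) * (c n m - d n m)
        = (a (n + 1) m + b (n + 1) m) - (a n (m + 1) + b n (m + 1))) ∧
     (∀ n m : ℕ, 1 ≤ n →
        a n (m + 1) * (c (n - 1) m - d (n - 1) m) = a n m * (c n m - d n m)) ∧
     (∀ n m : ℕ, 1 ≤ m →
        b (n + 1) m * (c n (m - 1) - d n (m - 1)) = b n m * (c n m - d n m))) := by
  have step : ∀ n m : ℕ, d (n + 1) m - d n m = c n (m + 1) - c n m →
      (b (n + 1) m - b n (m + 1) + a (n + 1) m - a n (m + 1)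
          = d (n + 1) m * c n m - d n m * c n (m + 1) ↔
        (c n (m + 1) - c n m) * (c n m - d n m)
          = (a (n + 1) m + b (n + 1) m) - (a n (m + 1) + b n (m + 1))) := by
    intro n m h
    constructor <;> intro h2 <;> linear_combination -h2 - c n m * h
  constructor
  · rintro ⟨h1, h2, h3⟩
    have h4 := fun n m => (step n m (h1 n m)).1 (h2 n m)
    exact ⟨h4, fun n m => by rw [h1, h4], h3⟩
  · rintro ⟨h1, h2, h3⟩
    have h4 : ∀ n m : ℕ, d (n + 1) m - d n m = c n (m + 1) - c n m := fun n m =>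
      mul_right_cancel₀ (sub_ne_zero.2 (hcd n m)) ((h2 n m).trans (h1 n m).symm)
    exact ⟨h4, fun n m => (step n m (h4 n m)).2 (h1 n m), h3⟩
end

section
/- Let α^{(1)}, α^{(2)}, α^{(3)}, α^{(4)}, α^{(5)}, β^{(1)} : ℕ×ℕ → ℂ and define for each n,m ≥ 0 the 3×3 matrices over the polynomial ring ℂ[x]: L_{n,m} with rows (x + α^{(1)}_{n,m}, α^{(2)}_{n,m}, α^{(3)}_{n,m}), (α^{(4)}_{n+1,m}, 0, 0), (α^{(5)}_{n+1,m}, 0, 1), and M_{n,m} with rows (x + β^{(1)}_{n,m}, α^{(2)}_{n,m}, α^{(3)}_{n,m}), (α^{(4)}_{n,m+1}, 1, 0), (α^{(5)}_{n,m+1}, 0, 0). Then the zero curvature condition L_{n,m+1} M_{n,m} = M_{n+1,m} L_{n,m} holds for a given pair (n,m) if and only if the following six scalar equations hold: (1) α^{(1)}_{n,m+1} + β^{(1)}_{n,m} = β^{(1)}_{n+1,m} + α^{(1)}_{n,m}; (2) α^{(1)}_{n,m+1}β^{(1)}_{n,m} + α^{(2)}_{n,m+1}α^{(4)}_{n,m+1}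 + α^{(3)}_{n,m+1}α^{(5)}_{n,m+1} = α^{(1)}_{n,m}β^{(1)}_{n+1,m} + α^{(2)}_{n+1,m}α^{(4)}_{n+1,m} + α^{(3)}_{n+1,m}α^{(5)}_{n+1,m}; (3) α^{(2)}_{n,m+1} = (β^{(1)}_{n+1,m} − α^{(1)}_{n,m+1}) α^{(2)}_{n,m}; (4) α^{(3)}_{n+1,m} = (α^{(1)}_{n,m+1} − β^{(1)}_{n+1,m}) α^{(3)}_{n,m}; (5) α^{(4)}_{n+1,m} = α^{(4)}_{n+1,m+1}(β^{(1)}_{n,m} − α^{(1)}_{n,m}); (6) α^{(5)}_{n,m+1} = α^{(5)}_{n+1,m+1}(α^{(1)}_{n,m} − β^{(1)}_{n,m}). -/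
open Polynomial

/-- The transition matrix `L_{n,m}` over `ℂ[x]`. -/
noncomputable def Lmat (α1 α2 α3 α4 α5 : ℕ → ℕ → ℂ) (n m : ℕ) :
    Matrix (Fin 3) (Fin 3) (Polynomial ℂ) :=
  !![X + C (α1 n m), C (α2 n m), C (α3 n m);
     C (α4 (n + 1) m), 0, 0;
     C (α5 (n + 1) m), 0, 1]

/-- The transition matrix `M_{n,m}` over `ℂ[x]`. -/
noncomputable def Mmat (β1 α2 α3 α4 α5 : ℕ → ℕ → ℂ) (n m : ℕ) :
    Matrix (Fin 3) (Fin 3) (Polynomial ℂ) :=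
  !![X + C (β1 n m), C (α2 n m), C (α3 n m);
     C (α4 n (m + 1)), 1, 0;
     C (α5 n (m + 1)), 0, 0]

/-- The zero curvature condition `L_{n,m+1} M_{n,m} = M_{n+1,m} L_{n,m}` at a given pair
`(n,m)` is equivalent to six scalar equations for the fields `α⁽¹⁾,…,α⁽⁵⁾,β⁽¹⁾`. -/
theorem zero_curvature_iff_six_equations (α1 α2 α3 α4 α5 β1 : ℕ → ℕ → ℂ) (n m : ℕ) :
    Lmat α1 α2 α3 α4 α5 n (m + 1) * Mmat β1 α2 α3 α4 α5 n m =
      Mmat β1 α2 α3 α4 α5 (n + 1) m * Lmat α1 α2 α3 α4 α5 n m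
    ↔
    (α1 n (m + 1) + β1 n m = β1 (n + 1) m + α1 n m ∧
     α1 n (m + 1) * β1 n m + α2 n (m + 1) * α4 n (m + 1) + α3 n (m + 1) * α5 n (m + 1)
       = α1 n m * β1 (n + 1) m + α2 (n + 1) m * α4 (n + 1) m + α3 (n + 1) m * α5 (n + 1) m ∧
     α2 n (m + 1) = (β1 (n + 1) m - α1 n (m + 1)) * α2 n m ∧
     α3 (n + 1) m = (α1 n (m + 1) - β1 (n + 1) m) * α3 n m ∧
     α4 (n + 1) m = α4 (n + 1) (m + 1) * (β1 n m - α1 n m) ∧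
     α5 n (m + 1) = α5 (n + 1) (m + 1) * (α1 n m - β1 n m)) := by
  rw [← Matrix.ext_iff]
  simp only [Lmat, Mmat, Fin.forall_fin_succ, Matrix.mul_apply, Fin.sum_univ_three]
  simp
  constructor
  · rintro ⟨⟨h00, h01, h02⟩, h10, h20⟩
    have e0 := congrArg (eval 0) h00
    have e1 := congrArg (eval 1) h00
    have e01 := congrArg (eval 0) h01
    have e02 := congrArg (eval 0) h02
    have e10 := congrArg (eval 0) h10
    have e20 := congrArg (eval 0) h20
    simp only [eval_add, eval_mul, eval_X, eval_C] at e0 e1 e01 e02 e10 e20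
    refine ⟨?_, ?_, ?_, ?_, ?_, ?_⟩
    · linear_combination e1 - e0
    · linear_combination e0
    · linear_combination e01
    · linear_combination -e02
    · linear_combination -e10
    · linear_combination e20
  · rintro ⟨h1, h2, h3, h4, h5, h6⟩
    replace h1 := congrArg (C : ℂ → ℂ[X]) h1
    replace h2 := congrArg (C : ℂ → ℂ[X]) h2
    replace h3 := congrArg (C : ℂ → ℂ[X]) h3
    replace h4 := congrArg (C : ℂ → ℂ[X]) h4
    replace h5 := congrArg (C : ℂ → ℂ[X]) h5
    replace h6 := congrArg (C : ℂ → ℂ[X]) h6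
    simp only [C_add, C_sub, C_mul] at h1 h2 h3 h4 h5 h6
    refine ⟨⟨?_, ?_, ?_⟩, ?_, ?_⟩
    · linear_combination X * h1 + h2
    · linear_combination h3
    · linear_combination -h4
    · linear_combination -h5
    · linear_combination h6
end

section
/- Let α^{(1)}, α^{(2)}, α^{(3)}, α^{(4)}, α^{(5)}, β^{(1)} : ℕ×ℕ → ℂ and suppose the zero curvature condition L_{n,m+1} M_{n,m} = M_{n+1,m} L_{n,m} holds for all n,m ≥ 0, where L and M are the 3×3 polynomial matrices of the stated form. Define c_{n,m} = −α^{(1)}_{n,m}, d_{n,m} = −β^{(1)}_{n,m}, a_{n,m} = −α^{(4)}_{n,m}α^{(2)}_{n,m}, b_{n,m} = −α^{(5)}_{n,m}α^{(3)}_{n,m}. Then: d_{n+1,m} − d_{n,m} = c_{n,m+1} − c_{n,m} for all n,m ≥ 0; b_{n+1,m} − b_{n,m+1} + a_{n+1,m} − a_{n,m+1} = d_{n+1,m}c_{n,m} − d_{n,m}c_{n,m+1} for all n,m ≥ 0; a_{n,m+1}(c_{n−1,m} − d_{n−1,m}) = a_{n,m}(c_{n,m} − d_{n,m}) for all n ≥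 1, m ≥ 0; and b_{n+1,m}(c_{n,m−1} − d_{n,m−1}) = b_{n,m}(c_{n,m} − d_{n,m}) for all n ≥ 0, m ≥ 1. -/
open Polynomial

/-- The entries of the zero curvature condition at `(n, m)`, compared coefficientwise. -/
theorem zero_curvature_entries {α1 α2 α3 α4 α5 β1 : ℕ → ℕ → ℂ} {n m : ℕ}
    (h : Lmat α1 α2 α3 α4 α5 n (m + 1) * Mmat β1 α2 α3 α4 α5 n m =
      Mmat β1 α2 α3 α4 α5 (n + 1) m * Lmat α1 α2 α3 α4 α5 n m) :
    α1 n (m + 1) + β1 n m = β1 (n + 1) m + α1 n m ∧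
    α1 n (m + 1) * β1 n m + α2 n (m + 1) * α4 n (m + 1) + α3 n (m + 1) * α5 n (m + 1) =
      β1 (n + 1) m * α1 n m + α2 (n + 1) m * α4 (n + 1) m + α3 (n + 1) m * α5 (n + 1) m ∧
    α1 n (m + 1) * α2 n m + α2 n (m + 1) = β1 (n + 1) m * α2 n m ∧
    α1 n (m + 1) * α3 n m = β1 (n + 1) m * α3 n m + α3 (n + 1) m ∧
    α4 (n + 1) (m + 1) * β1 n m = α4 (n + 1) (m + 1) * α1 n m + α4 (n + 1) m ∧
    α5 (n + 1) (m + 1) * β1 n m + α5 n (m + 1) = α5 (n + 1) (m + 1) * α1 n m := by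
  have key (x : ℂ) (i j : Fin 3) := congrArg (fun A => (A i j).eval x) h
  have h00 := key 0 0 0
  have h00' := key 1 0 0
  have h01 := key 0 0 1
  have h02 := key 0 0 2
  have h10 := key 0 1 0
  have h20 := key 0 2 0
  simp only [Lmat, Mmat, Matrix.mul_apply, Fin.sum_univ_three, Matrix.of_apply, Matrix.cons_val,
    eval_add, eval_mul, eval_X, eval_C, eval_zero, eval_one] at h00 h00' h01 h02 h10 h20
  refine ⟨?_, ?_, ?_, ?_, ?_, ?_⟩
  · linear_combination h00' - h00
  · linear_combination h00
  · linear_combination h01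
  · linear_combination h02
  · linear_combination h10
  · linear_combination h20

/-- If the zero curvature condition holds for all `n,m ≥ 0`, then the coefficients
`c = -α⁽¹⁾`, `d = -β⁽¹⁾`, `a = -α⁽⁴⁾α⁽²⁾`, `b = -α⁽⁵⁾α⁽³⁾` satisfy the
consistency conditions for the nearest-neighbor recurrence relations. -/
theorem zero_curvature_implies_consistency (α1 α2 α3 α4 α5 β1 : ℕ → ℕ → ℂ)
    (hzcc : ∀ n m : ℕ,
      Lmat α1 α2 α3 α4 α5 n (m + 1) * Mmat β1 α2 α3 α4 α5 n m =
        Mmat β1 α2 α3 α4 α5 (n + 1) m * Lmat α1 α2 α3 α4 α5 n m)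
    (a b c d : ℕ → ℕ → ℂ)
    (hc : ∀ n m, c n m = -α1 n m) (hd : ∀ n m, d n m = -β1 n m)
    (ha : ∀ n m, a n m = -(α4 n m * α2 n m)) (hb : ∀ n m, b n m = -(α5 n m * α3 n m)) :
    (∀ n m : ℕ, d (n + 1) m - d n m = c n (m + 1) - c n m) ∧
    (∀ n m : ℕ, b (n + 1) m - b n (m + 1) + a (n + 1) m - a n (m + 1)
      = d (n + 1) m * c n m - d n m * c n (m + 1)) ∧
    (∀ n m : ℕ, 1 ≤ n →
      a n (m + 1) * (c (n - 1) m - d (n - 1) m) = a n m * (c n m - d n m)) ∧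
    (∀ n m : ℕ, 1 ≤ m →
      b (n + 1) m * (c n (m - 1) - d n (m - 1)) = b n m * (c n m - d n m)) := by
  have key n m := zero_curvature_entries (hzcc n m)
  simp only [ha, hb, hc, hd]
  refine ⟨fun n m => ?_, fun n m => ?_, fun n m hn => ?_, fun n m hm => ?_⟩
  · linear_combination (key n m).1
  · linear_combination (key n m).2.1
  · obtain ⟨k, rfl⟩ := Nat.exists_eq_add_of_le' hn
    obtain ⟨h1, -, h2, -, -, -⟩ := key (k + 1) m
    obtain ⟨-, -, -, -, h4, -⟩ := key k m
    simp only [Nat.add_sub_cancel]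
    linear_combination -α2 (k + 1) (m + 1) * h4 - α4 (k + 1) m * h2 +
      α4 (k + 1) m * α2 (k + 1) m * h1
  · obtain ⟨k, rfl⟩ := Nat.exists_eq_add_of_le' hm
    obtain ⟨h1, -, -, h3, -, -⟩ := key n (k + 1)
    obtain ⟨-, -, -, -, -, h5⟩ := key n k
    simp only [Nat.add_sub_cancel]
    linear_combination -α3 (n + 1) (k + 1) * h5 - α5 n (k + 1) * h3 +
      α5 n (k + 1) * α3 n (k + 1) * h1
end

section
/- Let a, b, c, d : ℕ×ℕ → ℂ satisfy a_{0,m} = 0 for all m, b_{n,0} = 0 for all n, and the consistency conditions: d_{n+1,m} − d_{n,m} = c_{n,m+1} − c_{n,m} and b_{n+1,m} − b_{n,m+1} + a_{n+1,m} − a_{n,m+1} = d_{n+1,m}c_{n,m} − d_{n,m}c_{n,m+1} for all n,m ≥ 0; a_{n,m+1}(c_{n−1,m} − d_{n−1,m}) = a_{n,m}(c_{n,m} − d_{n,m}) for n ≥ 1; b_{n+1,m}(c_{n,m−1} − d_{n,m−1}) = b_{n,m}(c_{n,m} − d_{n,m}) for m ≥ 1. Then there exists a unique family of polynomials P_{n,m}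 ∈ ℂ[x] (n,m ≥ 0) with P_{0,0} = 1 satisfying both recurrence relations P_{n+1,m}(x) = (x − c_{n,m})P_{n,m}(x) − a_{n,m}P_{n−1,m}(x) − b_{n,m}P_{n,m−1}(x) and P_{n,m+1}(x) = (x − d_{n,m})P_{n,m}(x) − a_{n,m}P_{n−1,m}(x) − b_{n,m}P_{n,m−1}(x) for all n,m ≥ 0 (terms with a negative index omitted); moreover each P_{n,m} is monic of degree n+m. -/
open Polynomial

/-- `P : ℕ → ℕ → ℂ[x]` is a family of polynomials generated by the nearest-neighbor
recurrence relations with coefficients `a b c d` and initial value `P_{0,0} = 1`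
(terms with a negative index omitted). -/
def IsNNRFamily (a b c d : ℕ → ℕ → ℂ) (P : ℕ → ℕ → Polynomial ℂ) : Prop :=
  P 0 0 = 1 ∧
  (∀ n m : ℕ, P (n + 1) m =
    (X - C (c n m)) * P n m
      - (if n = 0 then 0 else C (a n m) * P (n - 1) m)
      - (if m = 0 then 0 else C (b n m) * P n (m - 1))) ∧
  (∀ n m : ℕ, P n (m + 1) =
    (X - C (d n m)) * P n m
      - (if n = 0 then 0 else C (a n m) * P (n - 1) m)
      - (if m = 0 then 0 else C (b n m) * P n (m - 1)))

/-- The polynomials generated by the three-term recurrence along the boundary `n = 0`. -/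
noncomputable def nnrBoundary (b d : ℕ → ℕ → ℂ) : ℕ → ℂ[X]
  | 0 => 1
  | 1 => X - C (d 0 0)
  | m + 2 => (X - C (d 0 (m + 1))) * nnrBoundary b d (m + 1) - C (b 0 (m + 1)) * nnrBoundary b d m

/-- The array obtained from `nnrBoundary` by `P_{n+1,m} = P_{n,m+1} + (d_{n,m} - c_{n,m}) P_{n,m}`,
the difference of the two nearest-neighbor recurrences. -/
noncomputable def nnrArray (b c d : ℕ → ℕ → ℂ) : ℕ → ℕ → ℂ[X]
  | 0, m => nnrBoundary b d m
  | n + 1, m => nnrArray b c d n (m + 1) + C (d n m - c n m) * nnrArray b c d n m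

theorem nnrArray_succ_left (b c d : ℕ → ℕ → ℂ) (n m : ℕ) :
    nnrArray b c d (n + 1) m =
      nnrArray b c d n (m + 1) + C (d n m - c n m) * nnrArray b c d n m := rfl

theorem nnrArray_succ_right (a b c d : ℕ → ℕ → ℂ)
    (ha0 : ∀ m, a 0 m = 0) (hb0 : ∀ n, b n 0 = 0)
    (h1 : ∀ n m : ℕ, d (n + 1) m - d n m = c n (m + 1) - c n m)
    (h2 : ∀ n m : ℕ, b (n + 1) m - b n (m + 1) + a (n + 1) m - a n (m + 1)
      = d (n + 1) m * c n m - d n m * c n (m + 1))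
    (h3 : ∀ n m : ℕ, 1 ≤ n →
      a n (m + 1) * (c (n - 1) m - d (n - 1) m) = a n m * (c n m - d n m))
    (h4 : ∀ n m : ℕ, 1 ≤ m →
      b (n + 1) m * (c n (m - 1) - d n (m - 1)) = b n m * (c n m - d n m)) (n m : ℕ) :
    nnrArray b c d n (m + 1) = (X - C (d n m)) * nnrArray b c d n m
      - C (a n m) * nnrArray b c d (n - 1) m - C (b n m) * nnrArray b c d n (m - 1) := by
  induction n generalizing m with
  | zero => cases m <;> simp [nnrArray, nnrBoundary, ha0, hb0]
  | succ n ih =>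
    set P := nnrArray b c d with hP
    have step (k l : ℕ) : P (k + 1) l = P k (l + 1) + (C (d k l) - C (c k l)) * P k l := by
      rw [← C_sub, hP, nnrArray_succ_left]
    have hA : C (a n (m + 1)) * P (n - 1) (m + 1) =
        C (a n (m + 1)) * P n m - C (a n m) * (C (d n m) - C (c n m)) * P (n - 1) m := by
      cases n with
      | zero => simp [ha0]
      | succ k =>
        have e := congrArg C (h3 (k + 1) m (by simp))
        simp only [C_mul, C_sub, Nat.add_sub_cancel] at e ⊢
        linear_combination (-C (a (k + 1) (m + 1))) * step k m + P k m * e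
    have hB : C (b (n + 1) m) * P (n + 1) (m - 1) =
        C (b (n + 1) m) * P n m + C (b n m) * (C (d n m) - C (c n m)) * P n (m - 1) := by
      cases m with
      | zero => simp [hb0]
      | succ l =>
        have e := congrArg C (h4 n (l + 1) (by simp))
        simp only [C_mul, C_sub, Nat.add_sub_cancel] at e ⊢
        linear_combination C (b (n + 1) (l + 1)) * step n l - P n l * e
    have e1 := congrArg C (h1 n m)
    have e2 := congrArg C (h2 n m)
    simp only [C_mul, C_sub, C_add] at e1 e2
    have s0 := step n m
    have s1 := step n (m + 1)
    have i0 := ih m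
    have i1 := ih (m + 1)
    simp only [Nat.add_sub_cancel] at i1 ⊢
    linear_combination s1 + i1 - (X - C (d (n + 1) m)) * s0 - hA + hB + (C (d n m) - C (c n m)) * i0
      + P n (m + 1) * e1 + P n m * e2 + C (d n m) * P n m * e1

theorem IsNNRFamily.ext {a b c d : ℕ → ℕ → ℂ} {P Q : ℕ → ℕ → ℂ[X]}
    (hP : IsNNRFamily a b c d P) (hQ : IsNNRFamily a b c d Q) : P = Q := by
  obtain ⟨hP0, hP1, hP2⟩ := hP
  obtain ⟨hQ0, hQ1, hQ2⟩ := hQ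
  suffices h : ∀ k n m : ℕ, n + m = k → P n m = Q n m from
    funext₂ fun n m ↦ h _ n m rfl
  intro k
  induction k using Nat.strong_induction_on with
  | _ k ih =>
    rintro (_ | n) m rfl
    · cases m with
      | zero => rw [hP0, hQ0]
      | succ m =>
        rw [hP2, hQ2, ih _ (by lia) 0 m rfl, ih _ (by lia) 0 (m - 1) rfl]
    · rw [hP1, hQ1, ih _ (by lia) n m rfl]
      congr 1
      · congr 1
        split_ifs with h
        · rfl
        · rw [ih _ (by lia) (n - 1) m rfl]
      · split_ifs with h
        · rfl
        · rw [ih _ (by lia) n (m - 1) rfl]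

theorem IsNNRFamily.isMonicOfDegree {a b c d : ℕ → ℕ → ℂ} {P : ℕ → ℕ → ℂ[X]}
    (hP : IsNNRFamily a b c d P) (n m : ℕ) : IsMonicOfDegree (P n m) (n + m) := by
  obtain ⟨hP0, hP1, hP2⟩ := hP
  have hlt {p : ℂ[X]} {z : ℂ} {k l : ℕ} (hp : IsMonicOfDegree p k) (h : k < l) :
      (C z * p).natDegree < l :=
    (natDegree_C_mul_le z p).trans_lt (hp.natDegree_eq ▸ h)
  suffices h : ∀ k n m : ℕ, n + m = k → IsMonicOfDegree (P n m) k from h _ n m rfl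
  intro k
  induction k using Nat.strong_induction_on with
  | _ k ih =>
    have main (n m : ℕ) (z : ℂ) (h : n + m + 1 = k) : IsMonicOfDegree
        ((X - C z) * P n m - (if n = 0 then 0 else C (a n m) * P (n - 1) m)
          - (if m = 0 then 0 else C (b n m) * P n (m - 1))) k := by
      subst h
      refine (IsMonicOfDegree.sub ?_ ?_).sub ?_
      · rw [add_comm]
        exact (isMonicOfDegree_X_sub_one z).mul (ih _ (by lia) n m rfl)
      · split_ifs
        · simp
        · exact hlt (ih _ (by lia) (n - 1) m rfl) (by lia)
      · split_ifs
        · simp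
        · exact hlt (ih _ (by lia) n (m - 1) rfl) (by lia)
    rintro (_ | n) m h
    · cases m with
      | zero => subst h; simp [hP0]
      | succ m => rw [hP2]; exact main 0 m _ (by lia)
    · rw [hP1]; exact main n m _ (by lia)

/-- Given recurrence coefficients satisfying the consistency conditions, there is a unique
family of polynomials with `P_{0,0} = 1` satisfying both nearest-neighbor recurrence
relations; moreover each `P_{n,m}` is monic of degree `n+m`. -/
theorem existsUnique_family_of_consistency (a b c d : ℕ → ℕ → ℂ)
    (ha0 : ∀ m, a 0 m = 0) (hb0 : ∀ n, b n 0 = 0)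
    (h1 : ∀ n m : ℕ, d (n + 1) m - d n m = c n (m + 1) - c n m)
    (h2 : ∀ n m : ℕ, b (n + 1) m - b n (m + 1) + a (n + 1) m - a n (m + 1)
      = d (n + 1) m * c n m - d n m * c n (m + 1))
    (h3 : ∀ n m : ℕ, 1 ≤ n →
      a n (m + 1) * (c (n - 1) m - d (n - 1) m) = a n m * (c n m - d n m))
    (h4 : ∀ n m : ℕ, 1 ≤ m →
      b (n + 1) m * (c n (m - 1) - d n (m - 1)) = b n m * (c n m - d n m)) :
    (∃! P : ℕ → ℕ → Polynomial ℂ, IsNNRFamily a b c d P) ∧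
    (∀ P : ℕ → ℕ → Polynomial ℂ, IsNNRFamily a b c d P →
      ∀ n m : ℕ, (P n m).Monic ∧ (P n m).natDegree = n + m) := by
  have hN : IsNNRFamily a b c d (nnrArray b c d) := by
    have hr := nnrArray_succ_right a b c d ha0 hb0 h1 h2 h3 h4
    have ha (n m : ℕ) : (if n = 0 then 0 else C (a n m) * nnrArray b c d (n - 1) m) =
        C (a n m) * nnrArray b c d (n - 1) m := by
      split_ifs with h
      · simp [h, ha0]
      · rfl
    have hb (n m : ℕ) : (if m = 0 then 0 else C (b n m) * nnrArray b c d n (m - 1)) =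
        C (b n m) * nnrArray b c d n (m - 1) := by
      split_ifs with h
      · simp [h, hb0]
      · rfl
    refine ⟨rfl, fun n m ↦ ?_, fun n m ↦ ?_⟩
    · rw [ha, hb, nnrArray_succ_left, hr, C_sub]
      ring
    · rw [ha, hb, hr]
  exact ⟨⟨_, hN, fun Q hQ ↦ hQ.ext hN⟩,
    fun P hP n m ↦ ⟨(hP.isMonicOfDegree n m).monic, (hP.isMonicOfDegree n m).natDegree_eq⟩⟩
end

section
/- Let Δ₁ = [a₁,b₁] and Δ₂ = [a₂,b₂] be disjoint compact intervals in ℝ and let μ₁, μ₂ be finite Borel measures with supp μ_j ⊆ Δ_j and supp μ_j infinite for j = 1,2. Let n,m ≥ 0 and let P be a nonvanishing real polynomial with deg P ≤ n+m satisfying ∫ x^ν P(x) dμ₁(x) = 0 for 0 ≤ ν ≤ n−1 and ∫ x^ν P(x) dμ₂(x) = 0 for 0 ≤ ν ≤ m−1. Then P has at least n distinct roots in the open interval (a₁,b₁) and at least m distinct roots in the open interval (a₂,b₂); consequently deg P = n+m, all roots of P are real and simple, exactly n of them lie in (a₁,b₁) and exactly m of them lie in (a₂,b₂). -/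
open MeasureTheory Polynomial

/-- A polynomial without zeros in the open interval `(a, b)` does not change sign on `[a, b]`. -/
theorem Polynomial.constant_sign_of_no_root_Ioo {a b : ℝ} {P : ℝ[X]}
    (h : ∀ x ∈ Set.Ioo a b, P.eval x ≠ 0) :
    (∀ x ∈ Set.Icc a b, 0 ≤ P.eval x) ∨ (∀ x ∈ Set.Icc a b, P.eval x ≤ 0) := by
  by_contra! hcon
  obtain ⟨⟨x, hx, hPx⟩, y, hy, hPy⟩ := hcon
  obtain ⟨z, hz, hPz⟩ := intermediate_value_uIcc (a := x) (b := y) (f := fun t => P.eval t)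
    P.continuous.continuousOn (Set.mem_uIcc.2 (Or.inl ⟨hPx.le, hPy.le⟩))
  have hzx : z ≠ x := by
    rintro rfl
    exact hPx.ne hPz
  have hzy : z ≠ y := by
    rintro rfl
    exact hPy.ne' hPz
  refine h z ?_ hPz
  rcases Set.mem_uIcc.1 hz with ⟨h₁, h₂⟩ | ⟨h₁, h₂⟩
  · exact ⟨hx.1.trans_lt (lt_of_le_of_ne h₁ hzx.symm), (lt_of_le_of_ne h₂ hzy).trans_le hy.2⟩
  · exact ⟨hy.1.trans_lt (lt_of_le_of_ne h₁ hzy.symm), (lt_of_le_of_ne h₂ hzx).trans_le hx.2⟩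

/-- A nonzero polynomial can be multiplied by a product of distinct linear factors, vanishing only
at zeros of the polynomial inside `(a, b)`, so that the result does not change sign on `[a, b]`. -/
theorem Polynomial.exists_finset_constant_sign (a b : ℝ) {P : ℝ[X]} (hP : P ≠ 0) :
    ∃ S : Finset ℝ, (S : Set ℝ) ⊆ Set.Ioo a b ∧ (∀ x ∈ S, P.eval x = 0) ∧
      ((∀ x ∈ Set.Icc a b, 0 ≤ ((∏ c ∈ S, (X - C c)) * P).eval x) ∨
        (∀ x ∈ Set.Icc a b, ((∏ c ∈ S, (X - C c)) * P).eval x ≤ 0)) := by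
  induction hd : P.natDegree generalizing P with
  | zero =>
    refine ⟨∅, by simp, by simp, ?_⟩
    obtain ⟨c, rfl⟩ := natDegree_eq_zero.1 hd
    rcases le_total 0 c with hc | hc
    · left; simp [hc]
    · right; simp [hc]
  | succ d ih =>
    by_cases hroot : ∀ x ∈ Set.Ioo a b, P.eval x ≠ 0
    · exact ⟨∅, by simp, by simp, by simpa using constant_sign_of_no_root_Ioo hroot⟩
    push Not at hroot
    obtain ⟨r, hr, hPr⟩ := hroot
    obtain ⟨R, rfl⟩ := dvd_iff_isRoot.2 hPr
    have hR : R ≠ 0 := right_ne_zero_of_mul hP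
    have hdR : R.natDegree = d := by
      rw [natDegree_mul (X_sub_C_ne_zero r) hR, natDegree_X_sub_C] at hd
      omega
    obtain ⟨S, hS, hSR, hsign⟩ := ih hR hdR
    by_cases hrS : r ∈ S
    · refine ⟨S.erase r, fun x hx => hS (Finset.mem_of_mem_erase hx), fun x hx => ?_, ?_⟩
      · simp [hSR x (Finset.mem_of_mem_erase hx)]
      · rwa [← mul_assoc, Finset.prod_erase_mul S (fun c => X - C c) hrS]
    · refine ⟨insert r S, ?_, fun x hx => ?_, ?_⟩
      · rw [Finset.coe_insert]
        exact Set.insert_subset hr hS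
      · rcases Finset.mem_insert.1 hx with rfl | hx
        · exact hPr
        · simp [hSR x hx]
      · have key : ∀ x, ((∏ c ∈ insert r S, (X - C c)) * ((X - C r) * R)).eval x =
            (x - r) ^ 2 * ((∏ c ∈ S, (X - C c)) * R).eval x := fun x => by
          rw [Finset.prod_insert hrS]
          simp only [eval_mul, eval_sub, eval_X, eval_C]
          ring
        simp only [key]
        exact hsign.imp (fun h x hx => mul_nonneg (sq_nonneg _) (h x hx))
          (fun h x hx => mul_nonpos_of_nonneg_of_nonpos (sq_nonneg _) (h x hx))

/-- Polynomials are integrable against a finite measure carried by a compact interval. -/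
theorem Polynomial.integrable_eval_of_compl_Icc_null {a b : ℝ} {μ : Measure ℝ} [IsFiniteMeasure μ]
    (hsupp : μ (Set.Icc a b)ᶜ = 0) (P : ℝ[X]) : Integrable (fun x => P.eval x) μ := by
  have h : IntegrableOn (fun x => P.eval x) (Set.Icc a b) μ :=
    P.continuous.continuousOn.integrableOn_compact isCompact_Icc
  have hae : ∀ᵐ x ∂μ, x ∈ Set.Icc a b := mem_ae_iff.2 hsupp
  rwa [IntegrableOn, Measure.restrict_eq_self_of_ae_mem hae] at h

/-- If a polynomial does not change sign on an interval carrying a finite measure with infinite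
support and its integral vanishes, then the polynomial is zero. -/
theorem Polynomial.eq_zero_of_nonneg_of_integral_eq_zero {a b : ℝ} {μ : Measure ℝ}
    [IsFiniteMeasure μ] (hsupp : μ (Set.Icc a b)ᶜ = 0)
    (hinf : ∀ F : Finset ℝ, μ ((F : Set ℝ))ᶜ ≠ 0) {P : ℝ[X]}
    (hP : ∀ x ∈ Set.Icc a b, 0 ≤ P.eval x) (hint : ∫ x, P.eval x ∂μ = 0) : P = 0 := by
  by_contra h0
  have hae : ∀ᵐ x ∂μ, x ∈ Set.Icc a b := mem_ae_iff.2 hsupp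
  have hzero := (integral_eq_zero_iff_of_nonneg_ae (hae.mono hP)
    (integrable_eval_of_compl_Icc_null hsupp P)).1 hint
  refine hinf P.roots.toFinset (mem_ae_iff.1 (hzero.mono fun x hx => ?_))
  simpa [h0] using hx

/-- A nonzero polynomial orthogonal to `1, x, …, x ^ (n - 1)` with respect to a finite measure with
infinite support in `[a, b]` has at least `n` distinct zeros in `(a, b)`. -/
theorem Polynomial.exists_finset_roots_of_orthogonal {a b : ℝ} {μ : Measure ℝ}
    [IsFiniteMeasure μ] (hsupp : μ (Set.Icc a b)ᶜ = 0)
    (hinf : ∀ F : Finset ℝ, μ ((F : Set ℝ))ᶜ ≠ 0) {n : ℕ} {P : ℝ[X]} (hP : P ≠ 0)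
    (horth : ∀ ν < n, ∫ x, x ^ ν * P.eval x ∂μ = 0) :
    ∃ T : Finset ℝ, T.card = n ∧ (T : Set ℝ) ⊆ Set.Ioo a b ∧ ∀ x ∈ T, P.eval x = 0 := by
  obtain ⟨S, hS, hSP, hsign⟩ := exists_finset_constant_sign a b hP
  suffices hn : n ≤ S.card by
    obtain ⟨T, hTS, hT⟩ := Finset.exists_subset_card_eq hn
    exact ⟨T, hT, fun x hx => hS (hTS hx), fun x hx => hSP x (hTS hx)⟩
  by_contra! hlt
  set Q : ℝ[X] := ∏ c ∈ S, (X - C c) with hQ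
  have hQdeg : Q.natDegree < n := by rwa [hQ, natDegree_finsetProd_X_sub_C_eq_card]
  have hQ0 : Q ≠ 0 := (monic_prod_X_sub_C _ _).ne_zero
  have hint : ∫ x, (Q * P).eval x ∂μ = 0 := by
    simp only [eval_mul, eval_eq_sum_range' hQdeg, Finset.sum_mul, mul_assoc]
    rw [integral_finsetSum]
    · refine Finset.sum_eq_zero fun i hi => ?_
      rw [integral_const_mul, horth i (Finset.mem_range.1 hi), mul_zero]
    · intro i _
      have h := integrable_eval_of_compl_Icc_null hsupp (X ^ i * P)
      simp only [eval_mul, eval_pow, eval_X] at h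
      exact h.const_mul (Q.coeff i)
  refine mul_ne_zero hQ0 hP ?_
  rcases hsign with h | h
  · exact eq_zero_of_nonneg_of_integral_eq_zero hsupp hinf h hint
  · refine neg_eq_zero.1 (eq_zero_of_nonneg_of_integral_eq_zero hsupp hinf
      (fun x hx => ?_) ?_)
    · rw [eval_neg]
      exact neg_nonneg.2 (h x hx)
    · simp only [eval_neg, integral_neg, hint, neg_zero]

/-- For an Angelesco system (two measures with infinite supports contained in disjoint
compact intervals), any nonzero polynomial of degree at most `n+m` satisfying the
multiple orthogonality relations has exactly `n+m` roots, all real and simple, with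
exactly `n` of them in the open interval `(a₁,b₁)` and exactly `m` in `(a₂,b₂)`. -/
theorem angelesco_zeros (a₁ b₁ a₂ b₂ : ℝ) (μ₁ μ₂ : Measure ℝ)
    [IsFiniteMeasure μ₁] [IsFiniteMeasure μ₂]
    (hdisj : Disjoint (Set.Icc a₁ b₁) (Set.Icc a₂ b₂))
    (hsupp₁ : μ₁ (Set.Icc a₁ b₁)ᶜ = 0) (hsupp₂ : μ₂ (Set.Icc a₂ b₂)ᶜ = 0)
    (hinf₁ : ∀ F : Finset ℝ, μ₁ ((F : Set ℝ))ᶜ ≠ 0)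
    (hinf₂ : ∀ F : Finset ℝ, μ₂ ((F : Set ℝ))ᶜ ≠ 0)
    (n m : ℕ) (P : Polynomial ℝ) (hP : P ≠ 0) (hdeg : P.natDegree ≤ n + m)
    (horth₁ : ∀ ν < n, ∫ x, x ^ ν * P.eval x ∂μ₁ = 0)
    (horth₂ : ∀ ν < m, ∫ x, x ^ ν * P.eval x ∂μ₂ = 0) :
    P.natDegree = n + m ∧
    ∃ T₁ T₂ : Finset ℝ, T₁.card = n ∧ T₂.card = m ∧
      (T₁ : Set ℝ) ⊆ Set.Ioo a₁ b₁ ∧ (T₂ : Set ℝ) ⊆ Set.Ioo a₂ b₂ ∧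
      P = C P.leadingCoeff * ∏ x ∈ T₁ ∪ T₂, (X - C x) := by
  obtain ⟨T₁, hc₁, hT₁, hr₁⟩ := exists_finset_roots_of_orthogonal hsupp₁ hinf₁ hP horth₁
  obtain ⟨T₂, hc₂, hT₂, hr₂⟩ := exists_finset_roots_of_orthogonal hsupp₂ hinf₂ hP horth₂
  have hT : Disjoint T₁ T₂ := by
    rw [← Finset.disjoint_coe]
    exact hdisj.mono (hT₁.trans Set.Ioo_subset_Icc_self) (hT₂.trans Set.Ioo_subset_Icc_self)
  have hcard : (T₁ ∪ T₂).card = n + m := by rw [Finset.card_union_of_disjoint hT, hc₁, hc₂]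
  have hle : (T₁ ∪ T₂).val ≤ P.roots := by
    refine (Multiset.le_iff_subset (T₁ ∪ T₂).nodup).2 fun x hx => (mem_roots hP).2 ?_
    rcases Finset.mem_union.1 hx with hx | hx
    · exact hr₁ x hx
    · exact hr₂ x hx
  have hroots : (T₁ ∪ T₂).val = P.roots :=
    Multiset.eq_of_le_of_card_le hle ((card_roots' P).trans (hdeg.trans hcard.ge))
  have hdegP : P.natDegree = n + m :=
    le_antisymm hdeg (hcard.symm.le.trans ((Multiset.card_le_card hle).trans (card_roots' P)))
  refine ⟨hdegP, T₁, T₂, hc₁, hc₂, hT₁, hT₂, ?_⟩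
  have hprod := C_leadingCoeff_mul_prod_multiset_X_sub_C
    (show Multiset.card P.roots = P.natDegree by rw [← hroots, hdegP]; exact hcard)
  rw [← hroots] at hprod
  exact hprod.symm
end

section
/- Let Δ₁ = [a₁,b₁] and Δ₂ = [a₂,b₂] be disjoint compact intervals in ℝ and let μ₁, μ₂ be finite Borel measures with supp μ_j ⊆ Δ_j and supp μ_j infinite for j = 1,2. Then the Angelesco system (μ₁,μ₂) is perfect: S_{n,m} ≠ 0 for all n,m ≥ 0. -/
open MeasureTheory Polynomial

/-- On a preconnected set, a nonzero real polynomial attains a constant sign after multiplication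
by linear factors at distinct roots of it lying in that set. -/
theorem exists_roots_subset_mul_prod_constant_sign {I : Set ℝ} (hI : IsPreconnected I)
    (P : ℝ[X]) (hP : P ≠ 0) :
    ∃ Z : Finset ℝ, Z ⊆ P.roots.toFinset ∧ (Z : Set ℝ) ⊆ I ∧
      ((∀ x ∈ I, 0 ≤ P.eval x * (∏ z ∈ Z, (X - C z)).eval x) ∨
        (∀ x ∈ I, P.eval x * (∏ z ∈ Z, (X - C z)).eval x ≤ 0)) := by
  classical
  induction hd : P.natDegree using Nat.strong_induction_on generalizing P with
  | _ d ih =>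
  subst hd
  by_cases hroot : ∃ r ∈ I, P.IsRoot r
  · obtain ⟨r, hrI, hr⟩ := hroot
    obtain ⟨R, rfl⟩ := dvd_iff_isRoot.mpr hr
    have hR : R ≠ 0 := right_ne_zero_of_mul hP
    have hdeg : R.natDegree < ((X - C r) * R).natDegree := by
      rw [natDegree_mul (X_sub_C_ne_zero r) hR, natDegree_X_sub_C]
      omega
    obtain ⟨Z, hZ, hZI, hsign⟩ := ih _ hdeg R hR rfl
    have hroots : ((X - C r) * R).roots.toFinset = insert r R.roots.toFinset := by
      rw [roots_mul hP, roots_X_sub_C, Multiset.toFinset_add, Multiset.toFinset_singleton]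
      rfl
    by_cases hrZ : r ∈ Z
    · refine ⟨Z.erase r, ?_, fun x hx => hZI (Finset.mem_of_mem_erase hx), ?_⟩
      · rw [hroots]
        exact ((Finset.erase_subset _ _).trans hZ).trans (Finset.subset_insert _ _)
      · have key : ∀ x, ((X - C r) * R).eval x * (∏ z ∈ Z.erase r, (X - C z)).eval x
            = R.eval x * (∏ z ∈ Z, (X - C z)).eval x := fun x => by
          rw [← Finset.mul_prod_erase Z _ hrZ]
          simp only [eval_mul]
          ring
        simpa only [key] using hsign
    · refine ⟨insert r Z, ?_, ?_, ?_⟩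
      · rw [hroots]
        exact Finset.insert_subset_insert _ hZ
      · rw [Finset.coe_insert]
        exact Set.insert_subset hrI hZI
      · have key : ∀ x, ((X - C r) * R).eval x * (∏ z ∈ insert r Z, (X - C z)).eval x
            = (x - r) ^ 2 * (R.eval x * (∏ z ∈ Z, (X - C z)).eval x) := fun x => by
          rw [Finset.prod_insert hrZ]
          simp only [eval_mul, eval_sub, eval_X, eval_C]
          ring
        simp only [key]
        exact hsign.imp (fun h x hx => mul_nonneg (sq_nonneg _) (h x hx))
          (fun h x hx => mul_nonpos_of_nonneg_of_nonpos (sq_nonneg _) (h x hx))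
  · refine ⟨∅, by simp, by simp, ?_⟩
    simp only [Finset.prod_empty, eval_one, mul_one]
    by_contra! h
    obtain ⟨⟨x, hx, hx0⟩, y, hy, hy0⟩ := h
    obtain ⟨z, hz, hz0⟩ := hI.intermediate_value hx hy P.continuous.continuousOn
      ⟨hx0.le, hy0.le⟩
    exact hroot ⟨z, hz, hz0⟩

/-- A continuous function is integrable for a finite measure carried by a compact interval. -/
theorem integrable_of_continuous_of_measure_compl_Icc_eq_zero {a b : ℝ} {μ : Measure ℝ}
    [IsFiniteMeasure μ] (hsupp : μ (Set.Icc a b)ᶜ = 0) {f : ℝ → ℝ} (hf : Continuous f) :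
    Integrable f μ := by
  rw [← Measure.restrict_eq_self_of_ae_mem (s := Set.Icc a b) (μ := μ) hsupp]
  exact hf.continuousOn.integrableOn_compact isCompact_Icc

/-- A nonzero polynomial orthogonal to `1, x, …, x ^ (n - 1)` has at least `n` distinct roots
in any compact interval carrying the measure. -/
theorem exists_roots_subset_of_orthogonal {a b : ℝ} {μ : Measure ℝ} [IsFiniteMeasure μ]
    (hsupp : μ (Set.Icc a b)ᶜ = 0) (hinf : ∀ F : Finset ℝ, μ ((F : Set ℝ))ᶜ ≠ 0)
    {n : ℕ} {P : ℝ[X]} (hP : P ≠ 0) (horth : ∀ j < n, ∫ x, P.eval x * x ^ j ∂μ = 0) :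
    ∃ Z : Finset ℝ, Z ⊆ P.roots.toFinset ∧ (Z : Set ℝ) ⊆ Set.Icc a b ∧ n ≤ Z.card := by
  obtain ⟨Z, hZ, hZI, hsign⟩ :=
    exists_roots_subset_mul_prod_constant_sign isPreconnected_Icc (I := Set.Icc a b) P hP
  refine ⟨Z, hZ, hZI, ?_⟩
  by_contra! hcard
  set Q : ℝ[X] := ∏ z ∈ Z, (X - C z) with hQ
  have hQmonic : Q.Monic := monic_prod_of_monic _ _ fun z _ => monic_X_sub_C z
  have hQdeg : Q.natDegree < n := by
    rw [hQ, natDegree_finsetProd_X_sub_C_eq_card]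
    exact hcard
  have hint : Integrable (fun x => P.eval x * Q.eval x) μ :=
    integrable_of_continuous_of_measure_compl_Icc_eq_zero hsupp (P.continuous.mul Q.continuous)
  have hzero : ∫ x, P.eval x * Q.eval x ∂μ = 0 := by
    have hexp : ∀ x, P.eval x * Q.eval x
        = ∑ j ∈ Finset.range n, Q.coeff j * (P.eval x * x ^ j) := fun x => by
      rw [eval_eq_sum_range' hQdeg, Finset.mul_sum]
      exact Finset.sum_congr rfl fun j _ => by ring
    simp only [hexp]
    rw [integral_finsetSum _ fun j _ =>
      integrable_of_continuous_of_measure_compl_Icc_eq_zero hsupp (by fun_prop)]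
    refine Finset.sum_eq_zero fun j hj => ?_
    rw [integral_const_mul, horth j (Finset.mem_range.mp hj), mul_zero]
  have hmem : ∀ᵐ x ∂μ, x ∈ Set.Icc a b := hsupp
  have hae : ∀ᵐ x ∂μ, P.eval x * Q.eval x = 0 := by
    rcases hsign with h | h
    · exact (integral_eq_zero_iff_of_nonneg_ae (hmem.mono h) hint).mp hzero
    · have hneg : ∫ x, -(P.eval x * Q.eval x) ∂μ = 0 := by rw [integral_neg, hzero, neg_zero]
      have h0 := (integral_eq_zero_iff_of_nonneg_ae
        (hmem.mono fun x hx => neg_nonneg.mpr (h x hx)) hint.neg).mp hneg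
      exact h0.mono fun x hx => neg_eq_zero.mp hx
  refine hinf (P * Q).roots.toFinset (measure_mono_null ?_ hae)
  intro x hx hx0
  refine hx ?_
  simpa [hP, hQmonic.ne_zero] using hx0

/-- Angelesco systems are perfect: for two measures with infinite supports contained in
disjoint compact intervals, all the determinants `S_{n,m}` are nonzero. -/
theorem angelesco_is_perfect (a₁ b₁ a₂ b₂ : ℝ) (μ₁ μ₂ : Measure ℝ)
    [IsFiniteMeasure μ₁] [IsFiniteMeasure μ₂]
    (hdisj : Disjoint (Set.Icc a₁ b₁) (Set.Icc a₂ b₂))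
    (hsupp₁ : μ₁ (Set.Icc a₁ b₁)ᶜ = 0) (hsupp₂ : μ₂ (Set.Icc a₂ b₂)ᶜ = 0)
    (hinf₁ : ∀ F : Finset ℝ, μ₁ ((F : Set ℝ))ᶜ ≠ 0)
    (hinf₂ : ∀ F : Finset ℝ, μ₂ ((F : Set ℝ))ᶜ ≠ 0) :
    ∀ n m : ℕ, Sdet μ₁ μ₂ n m ≠ 0 := by
  classical
  intro n m hdet
  obtain ⟨v, hv, hvM⟩ := Matrix.exists_vecMul_eq_zero_iff.mpr hdet
  set P : ℝ[X] := ∑ i : Fin (n + m), monomial (i : ℕ) (v i) with hPdef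
  have hcoeff : ∀ i : Fin (n + m), P.coeff i = v i := fun i => by
    simp [hPdef, coeff_monomial, Fin.val_inj]
  have hP : P ≠ 0 := fun h => hv <| funext fun i => by simp [← hcoeff, h]
  have hdeg : P.natDegree < n + m := by
    have hlt : P.degree < (n + m : ℕ) := by
      rw [← mem_degreeLT]
      exact Submodule.sum_mem _ fun i _ => mem_degreeLT.mpr
        ((degree_monomial_le _ _).trans_lt (by exact_mod_cast i.isLt))
    exact (natDegree_lt_iff_degree_lt hP).mpr hlt
  have hintegral : ∀ {a b : ℝ} {μ : Measure ℝ} [IsFiniteMeasure μ], μ (Set.Icc a b)ᶜ = 0 →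
      ∀ j : ℕ, ∫ x, P.eval x * x ^ j ∂μ = ∑ i : Fin (n + m), v i * mom μ (i + j) := by
    intro a b μ _ hsupp j
    have hexp : ∀ x, P.eval x * x ^ j = ∑ i : Fin (n + m), v i * x ^ ((i : ℕ) + j) := fun x => by
      rw [hPdef, eval_finsetSum, Finset.sum_mul]
      exact Finset.sum_congr rfl fun i _ => by rw [eval_monomial]; ring
    simp only [hexp]
    rw [integral_finsetSum _ fun i _ =>
      (integrable_of_continuous_of_measure_compl_Icc_eq_zero hsupp
        (continuous_pow _)).const_mul _]
    exact Finset.sum_congr rfl fun i _ => integral_const_mul _ _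
  obtain ⟨Z₁, hZ₁, hZI₁, hcard₁⟩ := exists_roots_subset_of_orthogonal hsupp₁ hinf₁ (n := n) hP
    fun j hj => by
      rw [hintegral hsupp₁]
      simpa [Matrix.vecMul, dotProduct, Smat, hj] using congrFun hvM ⟨j, by omega⟩
  obtain ⟨Z₂, hZ₂, hZI₂, hcard₂⟩ := exists_roots_subset_of_orthogonal hsupp₂ hinf₂ (n := m) hP
    fun j hj => by
      rw [hintegral hsupp₂]
      have hsub : ∀ i : ℕ, i + (n + j) - n = i + j := fun i => by omega
      simpa [Matrix.vecMul, dotProduct, Smat, hsub] using congrFun hvM ⟨n + j, by omega⟩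
  have hZdisj : Disjoint Z₁ Z₂ := Finset.disjoint_coe.mp (hdisj.mono hZI₁ hZI₂)
  have hle := Finset.card_le_card (Finset.union_subset hZ₁ hZ₂)
  rw [Finset.card_union_of_disjoint hZdisj] at hle
  have := P.roots.toFinset_card_le
  have := P.card_roots'
  omega
end

section
/- Let μ be a finite Borel measure on ℝ with compact support, let P be a real polynomial, and let n ≥ 0. Then ∫ x^k P(x) dμ(x) = 0 for all 0 ≤ k ≤ n−1 if and only if the function R(z) = ∫ P(x)/(z−x) dμ(x), defined for real z greater than the supremum of the support of μ, satisfies R(z) = O(z^{−(n+1)}) as z → +∞ (i.e., z^{n+1} R(z) stays bounded as z → +∞). -/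
open MeasureTheory Polynomial Filter Asymptotics

section CauchyTransform

variable {μ : Measure ℝ} [IsFiniteMeasure μ] {M : ℝ} {g : ℝ → ℝ}

theorem Continuous.integrable_of_ae_abs_le (hM : ∀ᵐ x ∂μ, |x| ≤ M) (hg : Continuous g) :
    Integrable g μ := by
  have h : μ.restrict (Set.Icc (-M) M) = μ :=
    Measure.restrict_eq_self_of_ae_mem (hM.mono fun x hx => abs_le.mp hx)
  rw [← h]
  exact hg.continuousOn.integrableOn_compact isCompact_Icc

theorem norm_mul_div_sub_le {x z : ℝ} (hx : |x| ≤ M) (hz : 2 * M < z) (c : ℝ) :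
    ‖z * (c / (z - x))‖ ≤ 2 * ‖c‖ := by
  have hx' := abs_le.mp hx
  have hzx : 0 < z - x := by linarith
  have hz0 : 0 < z := by linarith
  rw [norm_mul, norm_div, Real.norm_of_nonneg hz0.le, Real.norm_of_nonneg hzx.le, ← mul_div_assoc,
    div_le_iff₀ hzx]
  nlinarith [norm_nonneg c]

theorem integrable_div_sub (hM : ∀ᵐ x ∂μ, |x| ≤ M) (hg : Continuous g) {z : ℝ} (hz0 : 0 < z)
    (hz : 2 * M < z) : Integrable (fun x => g x / (z - x)) μ := by
  have h : Integrable (fun x => z * (g x / (z - x))) μ := by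
    refine ((hg.integrable_of_ae_abs_le hM).norm.const_mul 2).mono'
      (((hg.measurable.div (measurable_const.sub measurable_id)).const_mul z).aestronglyMeasurable) ?_
    filter_upwards [hM] with x hx using norm_mul_div_sub_le hx hz _
  exact (integrable_const_mul_iff (IsUnit.mk0 z hz0.ne') _).mp h

theorem isBigO_mul_cauchyTransform (hM : ∀ᵐ x ∂μ, |x| ≤ M) (hg : Continuous g) :
    (fun z : ℝ => z * ∫ x, g x / (z - x) ∂μ) =O[atTop] (fun _ : ℝ => (1 : ℝ)) := by
  refine IsBigO.of_bound (∫ x, 2 * ‖g x‖ ∂μ) ?_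
  filter_upwards [eventually_gt_atTop (2 * M)] with z hz
  rw [norm_one, mul_one, ← integral_const_mul]
  refine norm_integral_le_of_norm_le ((hg.integrable_of_ae_abs_le hM).norm.const_mul 2) ?_
  filter_upwards [hM] with x hx using norm_mul_div_sub_le hx hz _

theorem mul_cauchyTransform_eventuallyEq (hM : ∀ᵐ x ∂μ, |x| ≤ M) (hg : Continuous g) :
    (fun z : ℝ => z * ∫ x, g x / (z - x) ∂μ) =ᶠ[atTop]
      fun z => ∫ x, g x ∂μ + ∫ x, x * g x / (z - x) ∂μ := by
  filter_upwards [eventually_gt_atTop (2 * M), eventually_gt_atTop 0] with z hz hz0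
  rw [← integral_const_mul, ← integral_add (hg.integrable_of_ae_abs_le hM)
    (integrable_div_sub (g := fun x => x * g x) hM (by fun_prop) hz0 hz)]
  refine integral_congr_ae ?_
  filter_upwards [hM] with x hx
  have hx' := abs_le.mp hx
  have hzx : z - x ≠ 0 := by linarith
  field_simp
  ring

theorem tendsto_zero_of_isBigO_mul {f : ℝ → ℝ}
    (hf : (fun z : ℝ => z * f z) =O[atTop] (fun _ : ℝ => (1 : ℝ))) :
    Tendsto f atTop (nhds 0) := by
  have h : f =O[atTop] fun z : ℝ => z⁻¹ := by
    refine ((isBigO_refl (fun z : ℝ => z⁻¹) atTop).mul hf).congr' ?_ (by simp)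
    filter_upwards [eventually_ne_atTop 0] with z hz
    rw [inv_mul_cancel_left₀ hz]
  exact h.trans_tendsto tendsto_inv_atTop_zero

theorem integral_eq_zero_of_isBigO (hM : ∀ᵐ x ∂μ, |x| ≤ M) (hg : Continuous g) {n : ℕ}
    (h : (fun z : ℝ => z ^ (n + 2) * ∫ x, g x / (z - x) ∂μ) =O[atTop] (fun _ : ℝ => (1 : ℝ))) :
    ∫ x, g x ∂μ = 0 := by
  have h2 : (fun z : ℝ => z * (z * ∫ x, g x / (z - x) ∂μ)) =O[atTop] (fun _ : ℝ => (1 : ℝ)) := by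
    refine IsBigO.trans (IsBigO.of_bound 1 ?_) h
    filter_upwards [eventually_ge_atTop 1] with z hz
    rw [one_mul, ← mul_assoc, ← sq, norm_mul, norm_mul]
    gcongr ?_ * _
    rw [norm_pow, norm_pow]
    exact pow_le_pow_right₀ (hz.trans (le_abs_self z)) (by omega)
  have h3 := (tendsto_zero_of_isBigO_mul h2).congr' (mul_cauchyTransform_eventuallyEq hM hg)
  have h4 := (tendsto_zero_of_isBigO_mul
    (isBigO_mul_cauchyTransform hM (continuous_id'.mul hg))).const_add (∫ x, g x ∂μ)
  simpa using tendsto_nhds_unique h4 h3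

theorem moments_eq_zero_iff_isBigO (hM : ∀ᵐ x ∂μ, |x| ≤ M) (hg : Continuous g) (n : ℕ) :
    (∀ k < n, ∫ x, x ^ k * g x ∂μ = 0) ↔
      (fun z : ℝ => z ^ (n + 1) * ∫ x, g x / (z - x) ∂μ) =O[atTop] (fun _ : ℝ => (1 : ℝ)) := by
  induction n generalizing g with
  | zero => simpa using isBigO_mul_cauchyTransform hM hg
  | succ n ih =>
    have key (h0 : ∫ x, g x ∂μ = 0) :
        (fun z : ℝ => z ^ (n + 1 + 1) * ∫ x, g x / (z - x) ∂μ) =ᶠ[atTop]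
          fun z => z ^ (n + 1) * ∫ x, x * g x / (z - x) ∂μ := by
      filter_upwards [mul_cauchyTransform_eventuallyEq hM hg] with z hz
      rw [pow_succ, mul_assoc, hz, h0, zero_add]
    have shift := ih (g := fun x => x * g x) (by fun_prop)
    simp only [← mul_assoc, ← pow_succ] at shift
    rw [Nat.forall_lt_succ_left]
    simp only [pow_zero, one_mul]
    constructor
    · rintro ⟨h0, h⟩
      exact (key h0).trans_isBigO (shift.mp h)
    · intro h
      have h0 := integral_eq_zero_of_isBigO hM hg h
      exact ⟨h0, shift.mpr ((key h0).symm.trans_isBigO h)⟩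

end CauchyTransform

/-- For a finite compactly supported measure `μ` on `ℝ`, a polynomial `P` is orthogonal
to the first `n` monomials if and only if the Cauchy transform
`R(z) = ∫ P(x)/(z-x) dμ(x)` satisfies `R(z) = O(z^{-(n+1)})` as `z → +∞`, i.e.,
`z^{n+1} R(z)` stays bounded as `z → +∞`. -/
theorem orthogonality_iff_cauchy_transform_decay (μ : Measure ℝ) [IsFiniteMeasure μ]
    (hK : ∃ K : Set ℝ, IsCompact K ∧ μ Kᶜ = 0)
    (P : Polynomial ℝ) (n : ℕ) :
    (∀ k < n, ∫ x, x ^ k * P.eval x ∂μ = 0) ↔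
      (fun z : ℝ => z ^ (n + 1) * ∫ x, P.eval x / (z - x) ∂μ)
        =O[atTop] (fun _ : ℝ => (1 : ℝ)) := by
  obtain ⟨K, hKc, hK0⟩ := hK
  obtain ⟨M, hM⟩ := hKc.isBounded.exists_norm_le
  have hae : ∀ᵐ x ∂μ, |x| ≤ M := by
    filter_upwards [compl_mem_ae_iff.mpr hK0] with x hx using hM x (by simpa using hx)
  exact moments_eq_zero_iff_isBigO hae P.continuous n
end
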